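/- For positive integers a₁ ≥ a₂ ≥ a₃ ≥ a₄ ≥ a₅, the complete 5-partite graph K_{a₁,a₂,a₃,a₄,a₅} is NIC-planar if and only if a₁ = a₂ = a₃ = a₄ = a₅ = 1, i.e. the only NIC-planar complete 5-partite graph is K_{1,1,1,1,1}. -/

import Mathlib

open Set

/-- Two subsets of the plane *properly cross* at a point `p`: in some open
neighbourhood of `p` the pair of sets looks, up to homeomorphism, like the two
coordinate axes meeting at the origin. -/
def ProperCross (A₁ A₂ : Set (ℝ × ℝ)) (p : ℝ × ℝ) : Prop :=
  ∃ U : Set (ℝ × ℝ), IsOpen U ∧ ∃ hp : p ∈ U, ∃ φ : U ≃ₜ (ℝ × ℝ),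
    φ ⟨p, hp⟩ = (0, 0) ∧
    (fun x => φ x) '' {x : U | (x : ℝ × ℝ) ∈ A₁} = {q : ℝ × ℝ | q.2 = 0} ∧
    (fun x => φ x) '' {x : U | (x : ℝ × ℝ) ∈ A₂} = {q : ℝ × ℝ | q.1 = 0}

/-- A drawing of a simple graph `G` in the plane: vertices go to distinct points,
each edge is drawn as a continuous injective arc joining the points of its two
endpoints, no arc passes through the point of a vertex other than its endpoints,
arcs of edges sharing an endpoint meet only at that common point, any two arcs
meet in finitely many points, every intersection point of two arcs that is not a
common endpoint is a proper crossing, and no point of the plane that is not a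
vertex point lies on more than two arcs. -/
structure Drawing {V : Type*} (G : SimpleGraph V) where
  pos : V → ℝ × ℝ
  pos_inj : Function.Injective pos
  arc : G.edgeSet → ℝ → ℝ × ℝ
  arc_cont : ∀ e, ContinuousOn (arc e) (Icc 0 1)
  arc_inj : ∀ e, InjOn (arc e) (Icc 0 1)
  arc_ends : ∀ e : G.edgeSet, ∃ u v : V, (e : Sym2 V) = s(u, v) ∧
    arc e 0 = pos u ∧ arc e 1 = pos v
  no_vertex_interior : ∀ (e : G.edgeSet) (v : V), v ∉ (e : Sym2 V) →
    pos v ∉ arc e '' Icc 0 1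
  shared_endpoint : ∀ e₁ e₂ : G.edgeSet, e₁ ≠ e₂ → ∀ v : V,
    v ∈ (e₁ : Sym2 V) → v ∈ (e₂ : Sym2 V) →
    arc e₁ '' Icc 0 1 ∩ arc e₂ '' Icc 0 1 ⊆ {pos v}
  finite_meet : ∀ e₁ e₂ : G.edgeSet, e₁ ≠ e₂ →
    (arc e₁ '' Icc 0 1 ∩ arc e₂ '' Icc 0 1).Finite
  proper : ∀ e₁ e₂ : G.edgeSet, e₁ ≠ e₂ →
    ∀ p ∈ arc e₁ '' Icc 0 1 ∩ arc e₂ '' Icc 0 1, p ∉ Set.range pos →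
    ProperCross (arc e₁ '' Icc 0 1) (arc e₂ '' Icc 0 1) p
  at_most_two : ∀ p : ℝ × ℝ, p ∉ Set.range pos →
    ∀ e₁ e₂ e₃ : G.edgeSet, p ∈ arc e₁ '' Icc 0 1 → p ∈ arc e₂ '' Icc 0 1 →
      p ∈ arc e₃ '' Icc 0 1 → e₁ = e₂ ∨ e₁ = e₃ ∨ e₂ = e₃

namespace Drawing

variable {V : Type*} {G : SimpleGraph V}

/-- The image of the arc drawn for the edge `e`. -/
def arcIm (D : Drawing G) (e : G.edgeSet) : Set (ℝ × ℝ) :=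
  D.arc e '' Icc 0 1

/-- The set of crossings of the drawing: points that are not vertex points and
lie on (at least, hence exactly) two arcs.  (An intersection point of two arcs
that is a common endpoint of the two edges is a vertex point, and conversely a
vertex point on two arcs is a common endpoint, so these are precisely the
intersection points of pairs of arcs that are not common endpoints.) -/
def crossings (D : Drawing G) : Set (ℝ × ℝ) :=
  {p | p ∉ Set.range D.pos ∧ ∃ e₁ e₂ : G.edgeSet, e₁ ≠ e₂ ∧ p ∈ D.arcIm e₁ ∧ p ∈ D.arcIm e₂}

/-- The number of crossings of the drawing. -/
noncomputable def crossingCount (D : Drawing G) : ℕ := D.crossings.ncard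

/-- The cluster set `S(c)` of a crossing `c`: the set of end-vertices of the
(two) edges whose arcs pass through `c`. -/
def cluster (D : Drawing G) (c : ℝ × ℝ) : Set V :=
  {v | ∃ e : G.edgeSet, c ∈ D.arcIm e ∧ v ∈ (e : Sym2 V)}

/-- A drawing is 1-planar if each edge's arc is crossed at most once. -/
def IsOnePlanar (D : Drawing G) : Prop :=
  ∀ e : G.edgeSet, {p | p ∈ D.crossings ∧ p ∈ D.arcIm e}.Subsingleton

/-- A drawing is NIC-planar if it is 1-planar and the cluster sets of any two
distinct crossings share at most one vertex. -/
def IsNICPlanar (D : Drawing G) : Prop :=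
  D.IsOnePlanar ∧ ∀ c₁ ∈ D.crossings, ∀ c₂ ∈ D.crossings, c₁ ≠ c₂ →
    (D.cluster c₁ ∩ D.cluster c₂).ncard ≤ 1

/-- A drawing is IC-planar if it is 1-planar and the cluster sets of any two
distinct crossings are disjoint. -/
def IsICPlanar (D : Drawing G) : Prop :=
  D.IsOnePlanar ∧ ∀ c₁ ∈ D.crossings, ∀ c₂ ∈ D.crossings, c₁ ≠ c₂ →
    D.cluster c₁ ∩ D.cluster c₂ = ∅

end Drawing

/-- A graph is 1-planar if it admits a 1-planar drawing. -/
def SimpleGraph.OnePlanar {V : Type*} (G : SimpleGraph V) : Prop :=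
  ∃ D : Drawing G, D.IsOnePlanar

/-- A graph is NIC-planar if it admits an NIC-planar drawing. -/
def SimpleGraph.NICPlanar {V : Type*} (G : SimpleGraph V) : Prop :=
  ∃ D : Drawing G, D.IsNICPlanar

/-- A graph is IC-planar if it admits an IC-planar drawing. -/
def SimpleGraph.ICPlanar {V : Type*} (G : SimpleGraph V) : Prop :=
  ∃ D : Drawing G, D.IsICPlanar

/-- The crossing number of `G`: the minimum number of crossings over all
drawings of `G`. -/
noncomputable def SimpleGraph.crossingNumber {V : Type*} (G : SimpleGraph V) : ℕ :=
  sInf {n | ∃ D : Drawing G, D.crossingCount = n}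
/-- The graph `H` is a minimum non-NIC-planar graph: `H` is not NIC-planar but
deleting any single edge of `H` yields an NIC-planar graph. -/
def MinNonNICPlanar {V : Type*} (H : SimpleGraph V) : Prop :=
  ¬ H.NICPlanar ∧ ∀ e ∈ H.edgeSet, (H.deleteEdges {e}).NICPlanar

/-- The graph `H` is a minimum non-IC-planar graph: `H` is not IC-planar but
deleting any single edge of `H` yields an IC-planar graph. -/
def MinNonICPlanar {V : Type*} (H : SimpleGraph V) : Prop :=
  ¬ H.ICPlanar ∧ ∀ e ∈ H.edgeSet, (H.deleteEdges {e}).ICPlanar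

/-- The complete multipartite graph with parts of sizes `a 0, …, a (k-1)`. -/
abbrev completeMultipartite {k : ℕ} (a : Fin k → ℕ) :
    SimpleGraph (Σ i : Fin k, Fin (a i)) :=
  SimpleGraph.completeMultipartiteGraph fun i => Fin (a i)

/-- `G` contains a subgraph isomorphic to `H`, i.e. there is an injective graph
homomorphism from `H` to `G`. -/
def ContainsSubgraphIso {V W : Type*} (G : SimpleGraph V) (H : SimpleGraph W) : Prop :=
  ∃ f : H →g G, Function.Injective f

/-- Two continuous logarithms of the same nonvanishing path, up to a constant factor,
have the same total increment. -/
lemma log_increment_unique {F G : ℝ → ℂ} (hF : Continuous F) (hG : Continuous G) {c : ℂ}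
    (h : ∀ t, Complex.exp (F t) = c * Complex.exp (G t)) : F 1 - F 0 = G 1 - G 0 := by
  have key : F = fun t => G t + (F 0 - G 0) := by
    refine Complex.isCoveringMap_exp.eq_of_comp_eq hF (by fun_prop) ?_ 0 (by ring)
    funext t
    apply Subtype.ext
    have h0 := h 0
    simp only [Function.comp_apply, Complex.exp_add, Complex.exp_sub, h t, h0]
    field_simp [Complex.exp_ne_zero]
  rw [congrFun key 1]
  ring

/-- A nonvanishing continuous function on the plane has a continuous logarithm. -/
lemma exists_continuous_log {f : ℝ × ℝ → ℂ} (hf : Continuous f) (h0 : ∀ x, f x ≠ 0) :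
    ∃ F : ℝ × ℝ → ℂ, Continuous F ∧ ∀ x, Complex.exp (F x) = f x := by
  obtain ⟨F, ⟨-, hF⟩, -⟩ := Complex.isCoveringMapOn_exp.existsUnique_continuousMap_lifts
    ⟨f, hf⟩ (a₀ := 0) (Complex.exp_log (h0 0)) (fun x => h0 x)
  exact ⟨F, F.continuous, fun x => congrFun hF x⟩

/-- The increment of a logarithm along a path in the punctured plane is determined, up to a
multiple of `2πi`, by logarithms of the end points. -/
lemma exists_log_increment {g : ℝ → ℂ} (hg : Continuous g) (h0 : ∀ t, g t ≠ 0) {u v : ℂ}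
    (hu : Complex.exp u = g 0) (hv : Complex.exp v = g 1) :
    ∃ n : ℤ, ∀ (F : ℝ → ℂ) (c : ℂ), Continuous F → (∀ t, Complex.exp (F t) = c * g t) →
      F 1 - F 0 = v - u + n * (2 * Real.pi * Complex.I) := by
  obtain ⟨F, hF, hFg⟩ := exists_continuous_log (f := fun x => g x.1) (by fun_prop)
    (fun x => h0 x.1)
  obtain ⟨m, hm⟩ := Complex.exp_eq_exp_iff_exists_int.1 ((hFg (0, 0)).trans hu.symm)
  obtain ⟨n, hn⟩ := Complex.exp_eq_exp_iff_exists_int.1 ((hFg (1, 0)).trans hv.symm)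
  refine ⟨n - m, fun G c hG hGg => ?_⟩
  rw [log_increment_unique (G := fun t => F (t, 0)) (c := c) hG (by fun_prop)
    (fun t => by rw [hGg, hFg]), hn, hm]
  push_cast
  ring

/-- Every continuous map of `K_{3,3}` to the plane has two independent edges that meet. -/
theorem exists_independent_edges_meet (a b : Fin 3 → ℂ) (γ : Fin 3 → Fin 3 → ℝ → ℂ)
    (hγ : ∀ i j, Continuous (γ i j)) (h0 : ∀ i j, γ i j 0 = a i) (h1 : ∀ i j, γ i j 1 = b j) :
    ∃ i j k l, i ≠ k ∧ j ≠ l ∧ ∃ s t, γ i j s = γ k l t := by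
  by_contra! hd
  have exj : ∀ j : Fin 3, ∃ l, j ≠ l := by decide
  have ha : ∀ i k j t, k ≠ i → γ i j t - a k ≠ 0 := by
    intro i k j t hki
    obtain ⟨l, hl⟩ := exj j
    rw [← h0 k l]
    exact sub_ne_zero.2 (hd i j k l hki.symm hl t 0)
  have hb : ∀ i j l t, l ≠ j → γ i j t - b l ≠ 0 := by
    intro i j l t hlj
    obtain ⟨k, hk⟩ := exj i
    rw [← h1 k l]
    exact sub_ne_zero.2 (hd i j k l hk hlj.symm t 1)
  have hab : ∀ i j, b j - a i ≠ 0 := by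
    intro i j
    obtain ⟨k, hk⟩ := exj i
    rw [← h1 k j]
    exact ha k i j 1 hk
  have haa : ∀ i k, i ≠ k → a k - a i ≠ 0 := by
    intro i k hik
    rw [← h0 k 0]
    exact ha k i 0 0 hik
  have hbb : ∀ j l, j ≠ l → b l - b j ≠ 0 := by
    intro j l hjl
    rw [← h1 0 l]
    exact hb 0 l j 1 hjl
  have hpi : Complex.exp (Real.pi * Complex.I) = -1 := Complex.exp_pi_mul_I
  have logs : ∀ c : Fin 3 → ℂ, (∀ i k, i ≠ k → c k - c i ≠ 0) → ∃ q : Fin 3 → Fin 3 → ℂ,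
      (∀ i k, i ≠ k → Complex.exp (q i k) = c k - c i) ∧
      ∀ i k, i < k → q k i = q i k + Real.pi * Complex.I := by
    intro c hc
    refine ⟨fun i k => if i < k then Complex.log (c k - c i) else
      Complex.log (c i - c k) + Real.pi * Complex.I, fun i k hik => ?_, fun i k hik => ?_⟩
    · dsimp only
      split_ifs
      · exact Complex.exp_log (hc i k hik)
      · rw [Complex.exp_add, Complex.exp_log (hc k i hik.symm), hpi]
        ring
    · simp [hik, hik.le]
  obtain ⟨q, hq, hq'⟩ := logs a haa
  obtain ⟨r, hr, hr'⟩ := logs b hbb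
  have hA : ∀ k i j, ∃ n : ℤ, k ≠ i → ∀ (F : ℝ → ℂ) (c : ℂ), Continuous F →
      (∀ t, Complex.exp (F t) = c * (γ i j t - a k)) →
      F 1 - F 0 = Complex.log (b j - a k) - q k i + n * (2 * Real.pi * Complex.I) := by
    intro k i j
    by_cases hki : k = i
    · exact ⟨0, fun h => absurd hki h⟩
    · obtain ⟨n, hn⟩ := exists_log_increment (g := fun t => γ i j t - a k)
        ((hγ i j).sub continuous_const) (fun t => ha i k j t hki)
        (u := q k i) (v := Complex.log (b j - a k))
        (by rw [hq k i hki, h0]) (by rw [Complex.exp_log (hab k j), h1])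
      exact ⟨n, fun _ => hn⟩
  have hB : ∀ l i j, ∃ n : ℤ, l ≠ j → ∀ (F : ℝ → ℂ) (c : ℂ), Continuous F →
      (∀ t, Complex.exp (F t) = c * (γ i j t - b l)) →
      F 1 - F 0 = r l j - (Complex.log (b l - a i) + Real.pi * Complex.I)
        + n * (2 * Real.pi * Complex.I) := by
    intro l i j
    by_cases hlj : l = j
    · exact ⟨0, fun h => absurd hlj h⟩
    · obtain ⟨n, hn⟩ := exists_log_increment (g := fun t => γ i j t - b l)
        ((hγ i j).sub continuous_const) (fun t => hb i j l t hlj)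
        (u := Complex.log (b l - a i) + Real.pi * Complex.I) (v := r l j)
        (by rw [Complex.exp_add, Complex.exp_log (hab i l), hpi, h0]; ring)
        (by rw [hr l j hlj, h1])
      exact ⟨n, fun _ => hn⟩
  choose n hn using hA
  choose m hm using hB
  have square : ∀ i k j l, i < k → j ≠ l →
      n k i j + m j k l - n i k l - m l i j = if j < l then 1 else 0 := by
    intro i k j l hik hjl
    obtain ⟨F, hF, hFe⟩ := exists_continuous_log (f := fun x => γ i j x.1 - γ k l x.2)
      (((hγ i j).comp continuous_fst).sub ((hγ k l).comp continuous_snd))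
      (fun x => sub_ne_zero.2 (hd i j k l hik.ne hjl x.1 x.2))
    have e1 := hn k i j hik.ne' (fun t => F (t, 0)) 1 (by fun_prop)
      (fun t => by rw [hFe, h0, one_mul])
    have e2 := hm j k l hjl (fun t => F (1, t)) (-1) (by fun_prop)
      (fun t => by rw [hFe, h1]; ring)
    have e3 := hm l i j hjl.symm (fun t => F (t, 1)) 1 (by fun_prop)
      (fun t => by rw [hFe, h1, one_mul])
    have e4 := hn i k l hik.ne (fun t => F (0, t)) (-1) (by fun_prop)
      (fun t => by rw [hFe, h0]; ring)
    have e5 := hq' i k hik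
    have h2 : (2 * Real.pi * Complex.I : ℂ) ≠ 0 := Complex.two_pi_I_ne_zero
    have : ((n k i j + m j k l - n i k l - m l i j : ℤ) : ℂ) =
        ((if j < l then 1 else 0 : ℤ) : ℂ) := by
      apply mul_right_cancel₀ h2
      split_ifs with hlt
      · have e6 := hr' j l hlt
        push_cast
        linear_combination e4 + e3 - e1 - e2 + e5 + e6
      · have e6 := hr' l j (lt_of_le_of_ne (not_lt.1 hlt) hjl.symm)
        push_cast
        linear_combination e4 + e3 - e1 - e2 + e5 - e6
    exact_mod_cast this
  have s1 := square 0 1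
  have s2 := square 0 2
  have s3 := square 1 2
  simp only [Fin.forall_fin_succ, Fin.isValue] at s1 s2 s3
  simp at s1 s2 s3
  omega

namespace Drawing

variable {V : Type*} {G : SimpleGraph V}

/-- The arc of an edge, traversed from `u` to `v` and extended to the whole line. -/
lemma exists_path (D : Drawing G) {u v : V} (h : G.Adj u v) :
    ∃ γ : ℝ → ℂ, Continuous γ ∧ γ 0 = Complex.equivRealProdCLM.symm (D.pos u) ∧
      γ 1 = Complex.equivRealProdCLM.symm (D.pos v) ∧
      ∀ t, Complex.equivRealProdCLM (γ t) ∈ D.arcIm ⟨s(u, v), h⟩ := by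
  set e : G.edgeSet := ⟨s(u, v), h⟩ with he
  have hc : Continuous (IccExtend zero_le_one ((Icc (0 : ℝ) 1).domRestrict (D.arc e))) :=
    (continuousOn_iff_continuous_domRestrict.1 (D.arc_cont e)).Icc_extend'
  set g := IccExtend zero_le_one ((Icc (0 : ℝ) 1).domRestrict (D.arc e)) with hg
  have g0 : g 0 = D.arc e 0 := by simp [hg]
  have g1 : g 1 = D.arc e 1 := by simp [hg]
  have gm : ∀ t, g t ∈ D.arcIm e := fun t => ⟨projIcc 0 1 zero_le_one t, Subtype.prop _, rfl⟩
  obtain ⟨x, y, hxy, hx, hy⟩ := D.arc_ends e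
  rcases Sym2.eq_iff.1 hxy with ⟨rfl, rfl⟩ | ⟨rfl, rfl⟩
  · exact ⟨fun t => Complex.equivRealProdCLM.symm (g t), by fun_prop, by simp [g0, hx],
      by simp [g1, hy], fun t => by simpa using gm t⟩
  · exact ⟨fun t => Complex.equivRealProdCLM.symm (g (1 - t)), by fun_prop, by simp [g1, hy],
      by simp [g0, hx], fun t => by simpa using gm (1 - t)⟩

/-- In every drawing, any copy of `K_{3,3}` has two independent edges whose arcs meet. -/
lemma exists_meet_of_bipartite (D : Drawing G) (x y : Fin 3 → V) (h : ∀ i j, G.Adj (x i) (y j)) :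
    ∃ i j k l, i ≠ k ∧ j ≠ l ∧ ∃ p, p ∈ D.arcIm ⟨s(x i, y j), h i j⟩ ∧
      p ∈ D.arcIm ⟨s(x k, y l), h k l⟩ := by
  choose γ hγ h0 h1 hm using fun i j => D.exists_path (h i j)
  obtain ⟨i, j, k, l, hik, hjl, s, t, hst⟩ := exists_independent_edges_meet _ _ γ hγ h0 h1
  exact ⟨i, j, k, l, hik, hjl, _, hm i j s, hst ▸ hm k l t⟩

/-- A common point of the arcs of two edges without common end-vertex is a crossing. -/
lemma mem_crossings (D : Drawing G) {e₁ e₂ : G.edgeSet}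
    (h : ∀ v, v ∈ (e₁ : Sym2 V) → v ∉ (e₂ : Sym2 V)) {p : ℝ × ℝ} (h₁ : p ∈ D.arcIm e₁)
    (h₂ : p ∈ D.arcIm e₂) : p ∈ D.crossings := by
  refine ⟨?_, e₁, e₂, ?_, h₁, h₂⟩
  · rintro ⟨v, rfl⟩
    have m₁ : v ∈ (e₁ : Sym2 V) := by
      by_contra hv
      exact D.no_vertex_interior e₁ v hv h₁
    have m₂ : v ∈ (e₂ : Sym2 V) := by
      by_contra hv
      exact D.no_vertex_interior e₂ v hv h₂
    exact h v m₁ m₂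
  · rintro rfl
    exact h _ (Sym2.out_fst_mem _) (Sym2.out_fst_mem _)

end Drawing

/-- Among six vertices, any edge other than `01` can be put inside a side of a bipartition into
two triples, one of which contains both `0` and `1`. -/
lemma exists_bipartition (p q : Fin 6) (hpq : p ≠ q) : ∃ x y : Fin 3 → Fin 6,
    (∀ i j, x i ≠ y j ∧ ¬ (x i ≤ 1 ∧ y j ≤ 1) ∧ ¬ (x i = p ∧ y j = q) ∧ ¬ (x i = q ∧ y j = p)) ∧
    Function.Injective x ∧ Function.Injective y := by
  have h : ∀ p q : Fin 6, p ≠ q → ∃ n : Fin 4,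
      let x : Fin 3 → Fin 6 := ![0, 1, ![2, 3, 4, 5] n]
      let y : Fin 3 → Fin 6 := ![![3, 4, 5], ![2, 4, 5], ![2, 3, 5], ![2, 3, 4]] n
      (∀ i j, x i ≠ y j ∧ ¬ (x i ≤ 1 ∧ y j ≤ 1) ∧ ¬ (x i = p ∧ y j = q) ∧
        ¬ (x i = q ∧ y j = p)) ∧ Function.Injective x ∧ Function.Injective y := by
    decide
  obtain ⟨n, hn⟩ := h p q hpq
  exact ⟨_, _, hn⟩

/-- A graph containing six vertices, all but at most one pair of which are adjacent, is not
NIC-planar. -/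
theorem not_nicPlanar_of_six {V : Type*} [Finite V] {G : SimpleGraph V} (f : Fin 6 → V)
    (hf : Function.Injective f)
    (hadj : ∀ i j, i ≠ j → ¬ (i ≤ 1 ∧ j ≤ 1) → G.Adj (f i) (f j)) : ¬ G.NICPlanar := by
  rintro ⟨D, -, hD⟩
  have find : ∀ p q : Fin 6, p ≠ q → ∃ i j k l : Fin 6, ∃ hij : G.Adj (f i) (f j),
      ∃ hkl : G.Adj (f k) (f l), [i, j, k, l].Nodup ∧
      s(i, j) ≠ s(p, q) ∧ s(k, l) ≠ s(p, q) ∧ ∃ c, c ∈ D.arcIm ⟨s(f i, f j), hij⟩ ∧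
        c ∈ D.arcIm ⟨s(f k, f l), hkl⟩ := by
    intro p q hpq
    obtain ⟨x, y, hxy, hx, hy⟩ := exists_bipartition p q hpq
    obtain ⟨i, j, k, l, hik, hjl, c, hc, hc'⟩ := D.exists_meet_of_bipartite (fun i => f (x i))
      (fun j => f (y j)) (fun i j => hadj _ _ (hxy i j).1 (hxy i j).2.1)
    refine ⟨x i, y j, x k, y l, _, _, ?_, ?_, ?_, c, hc, hc'⟩
    · have := hx.ne hik
      have := hy.ne hjl
      have := (hxy i j).1
      have := (hxy i l).1
      have := (hxy k j).1
      have := (hxy k l).1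
      simp
      tauto
    · have := hxy i j
      simp only [ne_eq, Sym2.eq_iff]
      tauto
    · have := hxy k l
      simp only [ne_eq, Sym2.eq_iff]
      tauto
  have cross : ∀ i j k l : Fin 6, ∀ (hij : G.Adj (f i) (f j)) (hkl : G.Adj (f k) (f l)),
      [i, j, k, l].Nodup → ∀ c, c ∈ D.arcIm ⟨s(f i, f j), hij⟩ →
      c ∈ D.arcIm ⟨s(f k, f l), hkl⟩ →
      c ∈ D.crossings ∧ f '' {i, j, k, l} ⊆ D.cluster c := by
    intro i j k l hij hkl hnd c h₁ h₂
    refine ⟨D.mem_crossings ?_ h₁ h₂, ?_⟩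
    · simp at hnd
      intro v hv hv'
      rcases Sym2.mem_iff.1 hv with rfl | rfl <;> rcases Sym2.mem_iff.1 hv' with h | h <;>
        have := hf h <;> tauto
    · rintro _ ⟨v, hv, rfl⟩
      simp only [mem_insert_iff, mem_singleton_iff] at hv
      rcases hv with rfl | rfl | rfl | rfl
      · exact ⟨_, h₁, Sym2.mem_mk_left _ _⟩
      · exact ⟨_, h₁, Sym2.mem_mk_right _ _⟩
      · exact ⟨_, h₂, Sym2.mem_mk_left _ _⟩
      · exact ⟨_, h₂, Sym2.mem_mk_right _ _⟩
  have inj : ∀ {i j k l : Fin 6} (hij : G.Adj (f i) (f j)) (hkl : G.Adj (f k) (f l)),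
      (⟨s(f i, f j), hij⟩ : G.edgeSet) = ⟨s(f k, f l), hkl⟩ → s(i, j) = s(k, l) := by
    intro i j k l hij hkl h
    exact Sym2.map.injective hf (congrArg Subtype.val h)
  have four : ∀ i j k l : Fin 6, [i, j, k, l].Nodup → ({i, j, k, l} : Finset (Fin 6)).card = 4 := by
    intro i j k l h
    simpa using List.toFinset_card_of_nodup h
  obtain ⟨p, q, r, s, hpq, hrs, hnd, -, -, c, hc, hc'⟩ := find 0 1 (by decide)
  have hne : p ≠ q := by
    rintro rfl
    simp at hnd
  obtain ⟨i, j, k, l, hij, hkl, hnd', hne₁, hne₂, d, hd, hd'⟩ := find p q hne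
  obtain ⟨hcc, hcs⟩ := cross _ _ _ _ _ _ hnd _ hc hc'
  obtain ⟨hdc, hds⟩ := cross _ _ _ _ _ _ hnd' _ hd hd'
  have hcd : c ≠ d := by
    rintro rfl
    rcases D.at_most_two c hcc.1 _ _ _ hc hd hd' with h | h | h
    · exact hne₁ (inj _ _ h).symm
    · exact hne₂ (inj _ _ h).symm
    · have := inj _ _ h
      rw [Sym2.eq_iff] at this
      simp at hnd'
      tauto
  have hle := hD c hcc d hdc hcd
  have hsub : f '' (({p, q, r, s} ∩ {i, j, k, l} : Finset (Fin 6)) : Set (Fin 6)) ⊆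
      D.cluster c ∩ D.cluster d := by
    push_cast
    exact (image_inter_subset _ _ _).trans (inter_subset_inter hcs hds)
  have h2 := Set.ncard_le_ncard hsub (Set.toFinite _)
  rw [Set.ncard_image_of_injective _ hf, Set.ncard_coe_finset] at h2
  have h3 := Finset.card_union_add_card_inter ({p, q, r, s} : Finset (Fin 6)) {i, j, k, l}
  rw [four _ _ _ _ hnd, four _ _ _ _ hnd'] at h3
  have h4 := Finset.card_le_univ (({p, q, r, s} : Finset (Fin 6)) ∪ {i, j, k, l})
  rw [Fintype.card_fin] at h4
  omega

/-- Twice the signed area of the triangle `ABC`. -/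
def signedArea {R : Type*} [Ring R] (A B C : R × R) : R :=
  (B.1 - A.1) * (C.2 - A.2) - (B.2 - A.2) * (C.1 - A.1)

lemma mem_segment_prod_iff {A B x : ℝ × ℝ} : x ∈ segment ℝ A B ↔ ∃ t : ℝ, 0 ≤ t ∧ t ≤ 1 ∧
    x.1 = A.1 + t * (B.1 - A.1) ∧ x.2 = A.2 + t * (B.2 - A.2) := by
  rw [segment_eq_image']
  constructor
  · rintro ⟨t, ⟨h0, h1⟩, rfl⟩
    exact ⟨t, h0, h1, by simp, by simp⟩
  · rintro ⟨t, h0, h1, h2, h3⟩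
    exact ⟨t, ⟨h0, h1⟩, Prod.ext (by simp [h2]) (by simp [h3])⟩

/-- Two segments from `A` in different directions only meet in `A`. -/
lemma eq_of_mem_segments {A B C x : ℝ × ℝ} (h : signedArea A B C ≠ 0) (h₁ : x ∈ segment ℝ A B)
    (h₂ : x ∈ segment ℝ A C) : x = A := by
  obtain ⟨t, -, -, ht, ht'⟩ := mem_segment_prod_iff.1 h₁
  obtain ⟨s, -, -, hs, hs'⟩ := mem_segment_prod_iff.1 h₂
  have : s * signedArea A B C = 0 := by
    unfold signedArea
    linear_combination (B.1 - A.1) * (ht' - hs') - (B.2 - A.2) * (ht - hs)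
  have hs0 : s = 0 := (mul_eq_zero.1 this).resolve_right h
  subst hs0
  exact Prod.ext (by simpa using hs) (by simpa using hs')

/-- If `C` and `D` are strictly on the same side of the line `AB`, then the segments `AB` and `CD`
are disjoint. -/
lemma not_mem_segments {A B C D x : ℝ × ℝ} (h : 0 < signedArea A B C * signedArea A B D)
    (h₁ : x ∈ segment ℝ A B) (h₂ : x ∈ segment ℝ C D) : False := by
  obtain ⟨t, -, -, ht, ht'⟩ := mem_segment_prod_iff.1 h₁
  obtain ⟨s, hs0, hs1, hs, hs'⟩ := mem_segment_prod_iff.1 h₂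
  have : (1 - s) * signedArea A B C + s * signedArea A B D = 0 := by
    unfold signedArea
    linear_combination (B.1 - A.1) * (ht' - hs') - (B.2 - A.2) * (ht - hs)
  rcases pos_and_pos_or_neg_and_neg_of_mul_pos h with ⟨hc, hd⟩ | ⟨hc, hd⟩
  · rcases hs0.eq_or_lt with rfl | hpos
    · linarith
    · nlinarith [mul_pos hpos hd]
  · rcases hs0.eq_or_lt with rfl | hpos
    · linarith
    · nlinarith [mul_pos hpos (neg_pos.2 hd), mul_nonneg (sub_nonneg.2 hs1) (neg_pos.2 hc).le]

lemma ProperCross.symm {A₁ A₂ : Set (ℝ × ℝ)} {p : ℝ × ℝ} (h : ProperCross A₁ A₂ p) :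
    ProperCross A₂ A₁ p := by
  obtain ⟨U, hU, hp, φ, h0, h₁, h₂⟩ := h
  have hsw : ∀ S : Set U, (fun x => (φ.trans (Homeomorph.prodComm ℝ ℝ)) x) '' S =
      Prod.swap '' ((fun x => φ x) '' S) := fun S => by
    rw [image_image]
    rfl
  refine ⟨U, hU, hp, φ.trans (Homeomorph.prodComm ℝ ℝ), by simp [h0], ?_, ?_⟩
  · rw [hsw, h₂, image_swap_eq_preimage_swap]
    rfl
  · rw [hsw, h₁, image_swap_eq_preimage_swap]
    rfl

/-- Sets that coincide with the coordinate axes near the origin cross properly there. -/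
lemma properCross_of_axes {A₁ A₂ : Set (ℝ × ℝ)} (h₁ : ∀ x : ℝ × ℝ, ‖x‖ < 1 → (x ∈ A₁ ↔ x.2 = 0))
    (h₂ : ∀ x : ℝ × ℝ, ‖x‖ < 1 → (x ∈ A₂ ↔ x.1 = 0)) : ProperCross A₁ A₂ 0 := by
  have hb : ∀ q : ℝ × ℝ, ‖(Homeomorph.unitBall q : ℝ × ℝ)‖ < 1 := fun q =>
    mem_ball_zero_iff.1 (Homeomorph.unitBall q).2
  have hc : ∀ q : ℝ × ℝ, (√(1 + ‖q‖ ^ 2))⁻¹ ≠ 0 := fun q => by positivity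
  have hS : ∀ S : Set (Metric.ball (0 : ℝ × ℝ) 1), (fun x => Homeomorph.unitBall.symm x) '' S =
      {q | Homeomorph.unitBall q ∈ S} := fun S => Homeomorph.unitBall.symm.image_eq_preimage_symm S
  refine ⟨Metric.ball 0 1, Metric.isOpen_ball, by simp, Homeomorph.unitBall.symm, ?_, ?_, ?_⟩
  · rw [Homeomorph.symm_apply_eq]
    exact Subtype.ext Homeomorph.coe_unitBall_apply_zero.symm
  · rw [hS]
    ext q
    refine (h₁ _ (hb q)).trans ?_
    rw [Homeomorph.unitBall_apply_coe, OpenPartialHomeomorph.univUnitBall_apply, Prod.smul_snd,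
      smul_eq_zero, or_iff_right (hc q)]
    rfl
  · rw [hS]
    ext q
    refine (h₂ _ (hb q)).trans ?_
    rw [Homeomorph.unitBall_apply_coe, OpenPartialHomeomorph.univUnitBall_apply, Prod.smul_fst,
      smul_eq_zero, or_iff_right (hc q)]
    rfl

/-- Vertex positions, with integral coordinates, for a straight-line drawing of `K₅` whose
only crossing is at the origin. -/
def k5Lattice : Fin 5 → ℤ × ℤ := ![(4, 4), (-3, 0), (0, -3), (0, 1), (1, 0)]

/-- The positions `k5Lattice` as points of the plane. -/
def k5Point (i : Fin 5) : ℝ × ℝ := ((k5Lattice i).1, (k5Lattice i).2)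

lemma signedArea_k5Point (i j k : Fin 5) : signedArea (k5Point i) (k5Point j) (k5Point k) =
    (signedArea (k5Lattice i) (k5Lattice j) (k5Lattice k) : ℤ) := by
  simp [signedArea, k5Point]

lemma signedArea_k5Point_ne_zero {i j k : Fin 5} (hij : i ≠ j) (hik : i ≠ k) (hjk : j ≠ k) :
    signedArea (k5Point i) (k5Point j) (k5Point k) ≠ 0 := by
  rw [signedArea_k5Point, Int.cast_ne_zero]
  have : ∀ i j k : Fin 5, i ≠ j → i ≠ k → j ≠ k →
      signedArea (k5Lattice i) (k5Lattice j) (k5Lattice k) ≠ 0 := by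
    unfold signedArea k5Lattice
    decide
  exact this i j k hij hik hjk

lemma k5Point_injective : Function.Injective k5Point := by
  intro i j h
  have : k5Lattice i = k5Lattice j := by
    simp only [k5Point, Prod.mk.injEq, Int.cast_inj] at h
    exact Prod.ext h.1 h.2
  have hinj : Function.Injective k5Lattice := by
    unfold k5Lattice
    decide
  exact hinj this

/-- In the straight-line drawing of `K₅`, independent edges meet only if they are the two edges
`14` and `23` on the coordinate axes, and then in the origin. -/
lemma k5_meet {i j k l : Fin 5} (hij : i ≠ j) (hik : i ≠ k) (hil : i ≠ l) (hjk : j ≠ k)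
    (hjl : j ≠ l) (hkl : k ≠ l) {x : ℝ × ℝ} (h₁ : x ∈ segment ℝ (k5Point i) (k5Point j))
    (h₂ : x ∈ segment ℝ (k5Point k) (k5Point l)) :
    x = 0 ∧ (s(i, j) = s(1, 4) ∧ s(k, l) = s(2, 3) ∨ s(i, j) = s(2, 3) ∧ s(k, l) = s(1, 4)) := by
  have key : ∀ i j k l : Fin 5, i ≠ j → i ≠ k → i ≠ l → j ≠ k → j ≠ l → k ≠ l →
      0 < signedArea (k5Lattice i) (k5Lattice j) (k5Lattice k) *
        signedArea (k5Lattice i) (k5Lattice j) (k5Lattice l) ∨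
      0 < signedArea (k5Lattice k) (k5Lattice l) (k5Lattice i) *
        signedArea (k5Lattice k) (k5Lattice l) (k5Lattice j) ∨
      (s(i, j) = s(1, 4) ∧ s(k, l) = s(2, 3) ∨ s(i, j) = s(2, 3) ∧ s(k, l) = s(1, 4)) := by
    unfold signedArea k5Lattice
    decide
  have axis : ∀ {y : ℝ × ℝ}, y ∈ segment ℝ (k5Point 1) (k5Point 4) → y.2 = 0 := by
    intro y hy
    obtain ⟨t, -, -, -, h⟩ := mem_segment_prod_iff.1 hy
    simpa [k5Point, k5Lattice] using h
  have axis' : ∀ {y : ℝ × ℝ}, y ∈ segment ℝ (k5Point 2) (k5Point 3) → y.1 = 0 := by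
    intro y hy
    obtain ⟨t, -, -, h, -⟩ := mem_segment_prod_iff.1 hy
    simpa [k5Point, k5Lattice] using h
  have seg : ∀ {a b c d : Fin 5}, s(a, b) = s(c, d) → x ∈ segment ℝ (k5Point a) (k5Point b) →
      x ∈ segment ℝ (k5Point c) (k5Point d) := by
    intro a b c d h hx
    rcases Sym2.eq_iff.1 h with ⟨rfl, rfl⟩ | ⟨rfl, rfl⟩
    · exact hx
    · rwa [segment_symm]
  rcases key i j k l hij hik hil hjk hjl hkl with h | h | h
  · refine (not_mem_segments ?_ h₁ h₂).elim
    rw [signedArea_k5Point, signedArea_k5Point]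
    exact_mod_cast h
  · refine (not_mem_segments ?_ h₂ h₁).elim
    rw [signedArea_k5Point, signedArea_k5Point]
    exact_mod_cast h
  · refine ⟨?_, h⟩
    rcases h with ⟨h, h'⟩ | ⟨h, h'⟩
    · exact Prod.ext (axis' (seg h' h₂)) (axis (seg h h₁))
    · exact Prod.ext (axis' (seg h h₁)) (axis (seg h' h₂))

lemma k5_properCross : ProperCross (segment ℝ (k5Point 1) (k5Point 4))
    (segment ℝ (k5Point 2) (k5Point 3)) 0 := by
  apply properCross_of_axes
  · rintro ⟨x, y⟩ h
    rw [Prod.norm_mk, max_lt_iff, Real.norm_eq_abs, abs_lt] at h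
    rw [mem_segment_prod_iff]
    simp only [k5Point, k5Lattice]
    constructor
    · rintro ⟨t, -, -, -, h⟩
      simpa using h
    · rintro rfl
      exact ⟨(x + 3) / 4, by linarith, by linarith, by simp; ring, by simp⟩
  · rintro ⟨x, y⟩ h
    rw [Prod.norm_mk, max_lt_iff, Real.norm_eq_abs, Real.norm_eq_abs, abs_lt, abs_lt] at h
    rw [mem_segment_prod_iff]
    simp only [k5Point, k5Lattice]
    constructor
    · rintro ⟨t, -, -, h, -⟩
      simpa using h
    · rintro rfl
      exact ⟨(y + 3) / 4, by linarith, by linarith, by simp, by simp; ring⟩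

/-- Every graph on at most five vertices is NIC-planar. -/
theorem nicPlanar_of_injective_fin_five {V : Type*} (G : SimpleGraph V) (π : V → Fin 5)
    (hπ : Function.Injective π) : G.NICPlanar := by
  classical
  let arc : G.edgeSet → ℝ → ℝ × ℝ := fun e =>
    AffineMap.lineMap (k5Point (π (e : Sym2 V).out.1)) (k5Point (π (e : Sym2 V).out.2))
  have rep : ∀ e : G.edgeSet, ∃ u v, (e : Sym2 V) = s(u, v) ∧ π u ≠ π v := by
    rintro ⟨⟨u, v⟩, h⟩
    exact ⟨u, v, rfl, hπ.ne (G.ne_of_adj h)⟩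
  have out : ∀ e : Sym2 V, e = s(e.out.1, e.out.2) := fun e => (Quot.out_eq e).symm
  have im : ∀ (e : G.edgeSet) (u v : V), (e : Sym2 V) = s(u, v) →
      arc e '' Icc 0 1 = segment ℝ (k5Point (π u)) (k5Point (π v)) := by
    intro e u v h
    rw [← segment_eq_image_lineMap]
    rw [out e, Sym2.eq_iff] at h
    rcases h with ⟨h₁, h₂⟩ | ⟨h₁, h₂⟩
    · rw [h₁, h₂]
    · rw [h₁, h₂, segment_symm]
  have shared : ∀ e₁ e₂ : G.edgeSet, e₁ ≠ e₂ → ∀ v : V, v ∈ (e₁ : Sym2 V) → v ∈ (e₂ : Sym2 V) →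
      arc e₁ '' Icc 0 1 ∩ arc e₂ '' Icc 0 1 ⊆ {k5Point (π v)} := by
    intro e₁ e₂ hne v hv₁ hv₂ x hx
    obtain ⟨u, hu⟩ := hv₁
    obtain ⟨w, hw⟩ := hv₂
    rw [im e₁ v u hu, im e₂ v w hw] at hx
    have a₁ : G.Adj v u := by simpa [hu] using e₁.2
    have a₂ : G.Adj v w := by simpa [hw] using e₂.2
    have huw : u ≠ w := by
      rintro rfl
      exact hne (Subtype.ext (hu.trans hw.symm))
    exact eq_of_mem_segments (signedArea_k5Point_ne_zero (hπ.ne a₁.ne) (hπ.ne a₂.ne) (hπ.ne huw))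
      hx.1 hx.2
  have indep : ∀ e₁ e₂ : G.edgeSet, (∀ v, v ∈ (e₁ : Sym2 V) → v ∉ (e₂ : Sym2 V)) →
      ∀ x ∈ arc e₁ '' Icc 0 1 ∩ arc e₂ '' Icc 0 1, x = 0 ∧
        ((e₁ : Sym2 V).map π = s(1, 4) ∧ (e₂ : Sym2 V).map π = s(2, 3) ∨
         (e₁ : Sym2 V).map π = s(2, 3) ∧ (e₂ : Sym2 V).map π = s(1, 4)) := by
    intro e₁ e₂ h x hx
    obtain ⟨u, v, h₁, huv⟩ := rep e₁
    obtain ⟨u', v', h₂, huv'⟩ := rep e₂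
    rw [im e₁ u v h₁, im e₂ u' v' h₂] at hx
    simp only [h₁, h₂, Sym2.mem_iff, forall_eq_or_imp, forall_eq, not_or] at h
    rw [h₁, h₂]
    exact k5_meet huv (hπ.ne h.1.1) (hπ.ne h.1.2) (hπ.ne h.2.1) (hπ.ne h.2.2) huv' hx.1 hx.2
  have cross : ∀ e₁ e₂ : G.edgeSet, e₁ ≠ e₂ → ∀ x ∈ arc e₁ '' Icc 0 1 ∩ arc e₂ '' Icc 0 1,
      x ∉ Set.range (fun v => k5Point (π v)) → x = 0 ∧
        ((e₁ : Sym2 V).map π = s(1, 4) ∧ (e₂ : Sym2 V).map π = s(2, 3) ∨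
         (e₁ : Sym2 V).map π = s(2, 3) ∧ (e₂ : Sym2 V).map π = s(1, 4)) := by
    intro e₁ e₂ hne x hx hxr
    refine indep e₁ e₂ (fun v h₁ h₂ => hxr ⟨v, ?_⟩) x hx
    exact (shared e₁ e₂ hne v h₁ h₂ hx).symm
  have inj : ∀ e₁ e₂ : G.edgeSet, (e₁ : Sym2 V).map π = (e₂ : Sym2 V).map π → e₁ = e₂ :=
    fun e₁ e₂ h => Subtype.ext (Sym2.map.injective hπ h)
  have im' : ∀ (e : G.edgeSet) (i j : Fin 5), (e : Sym2 V).map π = s(i, j) →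
      arc e '' Icc 0 1 = segment ℝ (k5Point i) (k5Point j) := by
    intro e i j h
    obtain ⟨u, v, huv, -⟩ := rep e
    rw [im e u v huv]
    rw [huv, Sym2.map_mk, Sym2.eq_iff] at h
    rcases h with ⟨h₁, h₂⟩ | ⟨h₁, h₂⟩
    · rw [h₁, h₂]
    · rw [h₁, h₂, segment_symm]
  let D : Drawing G :=
    { pos := fun v => k5Point (π v)
      pos_inj := k5Point_injective.comp hπ
      arc := arc
      arc_cont := fun e => AffineMap.lineMap_continuous.continuousOn
      arc_inj := by
        intro e
        refine (AffineMap.lineMap_injective ℝ (k5Point_injective.ne (hπ.ne ?_))).injOn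
        have h := e.2
        rw [out e] at h
        exact G.ne_of_adj h
      arc_ends := fun e => ⟨(e : Sym2 V).out.1, (e : Sym2 V).out.2, out e, by simp [arc],
        by simp [arc]⟩
      no_vertex_interior := by
        intro e v hv h
        obtain ⟨u, w, huw, hne⟩ := rep e
        rw [im e u w huw] at h
        rw [huw, Sym2.mem_iff, not_or] at hv
        refine hv.1 (hπ (k5Point_injective (eq_of_mem_segments (signedArea_k5Point_ne_zero
          hne (hπ.ne (Ne.symm hv.1)) (hπ.ne (Ne.symm hv.2))) h (right_mem_segment _ _ _))))
      shared_endpoint := shared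
      finite_meet := by
        intro e₁ e₂ hne
        by_cases h : ∀ v, v ∈ (e₁ : Sym2 V) → v ∉ (e₂ : Sym2 V)
        · exact (finite_singleton 0).subset fun x hx => (indep e₁ e₂ h x hx).1
        · push Not at h
          obtain ⟨v, h₁, h₂⟩ := h
          exact (finite_singleton _).subset (shared e₁ e₂ hne v h₁ h₂)
      proper := by
        intro e₁ e₂ hne x hx hxr
        obtain ⟨rfl, ⟨h₁, h₂⟩ | ⟨h₁, h₂⟩⟩ := cross e₁ e₂ hne x hx hxr
        · rw [im' e₁ _ _ h₁, im' e₂ _ _ h₂]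
          exact k5_properCross
        · rw [im' e₁ _ _ h₁, im' e₂ _ _ h₂]
          exact k5_properCross.symm
      at_most_two := by
        intro x hxr e₁ e₂ e₃ h₁ h₂ h₃
        by_contra! hne
        obtain ⟨-, h⟩ := cross e₁ e₂ hne.1 x ⟨h₁, h₂⟩ hxr
        obtain ⟨-, h'⟩ := cross e₁ e₃ hne.2.1 x ⟨h₁, h₃⟩ hxr
        refine hne.2.2 (inj _ _ ?_)
        rcases h with ⟨a, b⟩ | ⟨a, b⟩ <;> rcases h' with ⟨a', b'⟩ | ⟨a', b'⟩
        · rw [b, b']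
        · exact absurd (a.symm.trans a') (by decide)
        · exact absurd (a.symm.trans a') (by decide)
        · rw [b, b'] }
  have zero : ∀ x ∈ D.crossings, x = 0 := by
    rintro x ⟨hxr, e₁, e₂, hne, h₁, h₂⟩
    exact (cross e₁ e₂ hne x ⟨h₁, h₂⟩ hxr).1
  exact ⟨D, fun e x hx y hy => (zero x hx.1).trans (zero y hy.1).symm,
    fun c₁ h₁ c₂ h₂ hne => absurd ((zero c₁ h₁).trans (zero c₂ h₂).symm) hne⟩

/-- for positive integers `a₁ ≥ a₂ ≥ a₃ ≥ a₄ ≥ a₅`, the complete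
5-partite graph `K_{a₁,a₂,a₃,a₄,a₅}` is NIC-planar iff all parts have size one. -/
theorem stmt8 (a₁ a₂ a₃ a₄ a₅ : ℕ) (h₅ : 0 < a₅) (h₅₄ : a₅ ≤ a₄) (h₄₃ : a₄ ≤ a₃)
    (h₃₂ : a₃ ≤ a₂) (h₂₁ : a₂ ≤ a₁) :
    (completeMultipartite ![a₁, a₂, a₃, a₄, a₅]).NICPlanar ↔
      a₁ = 1 ∧ a₂ = 1 ∧ a₃ = 1 ∧ a₄ = 1 ∧ a₅ = 1 := by
  constructor
  · intro h
    by_contra hne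
    have h2 : 1 < a₁ := by omega
    have hpos : ∀ i, 0 < ![a₁, a₂, a₃, a₄, a₅] i := by
      simp [Fin.forall_fin_succ]
      omega
    let f : Fin 6 → Σ i : Fin 5, Fin (![a₁, a₂, a₃, a₄, a₅] i) :=
      Fin.cons ⟨0, ⟨1, h2⟩⟩ fun i => ⟨i, ⟨0, hpos i⟩⟩
    have hf1 : ∀ i j, i ≠ j → ¬ (i ≤ 1 ∧ j ≤ 1) → (f i).1 ≠ (f j).1 := by
      have : ∀ i, (f i).1 = (Fin.cons 0 id : Fin 6 → Fin 5) i := by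
        intro i
        cases i using Fin.cases <;> rfl
      simp only [this]
      decide
    refine not_nicPlanar_of_six f ?_ hf1 h
    rw [Fin.cons_injective_iff]
    refine ⟨?_, fun i j hij => congrArg Sigma.fst hij⟩
    rintro ⟨i, hi⟩
    obtain rfl : i = 0 := congrArg Sigma.fst hi
    exact absurd (congrArg Fin.val (eq_of_heq (Sigma.mk.inj hi).2)) (by simp)
  · rintro ⟨rfl, rfl, rfl, rfl, rfl⟩
    refine nicPlanar_of_injective_fin_five _ Sigma.fst ?_
    have hone : ∀ i, ![1, 1, 1, 1, 1] i = 1 := by decide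
    rintro ⟨i, x⟩ ⟨j, y⟩ (rfl : i = j)
    have : Subsingleton (Fin (![1, 1, 1, 1, 1] i)) := by
      rw [hone]
      infer_instance
    rw [Subsingleton.elim x y]
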